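/- arXiv:2101.12429 — 2 statements merged into one kernel-verified Lean document; each statement's English description precedes it below -/
import Mathlib

section
/- For all positive real numbers γ, σ̄_t, σ̄_c, the Laplace-type integral of the Rayleigh clutter-cross-section density satisfies ∫₀^∞ exp(-γσ/σ̄_t) · (2σ/σ̄_c²) · exp(-(σ/σ̄_c)²) dσ = 1 − (√π·ν/2) · exp(ν²/4) · erfc(ν/2), where ν = γσ̄_c/σ̄_t and erfc(x) = (2/√π)∫_x^∞ exp(-t²) dt is the complementary error function. (This is the term J for Weibull shape parameter α = 2.) -/
open MeasureTheory Real Set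

/-- The complementary error function `erfc x = (2/√π) ∫_x^∞ exp(-t²) dt`. -/
noncomputable def erfc (x : ℝ) : ℝ :=
  (2 / Real.sqrt Real.pi) * ∫ t in Ioi x, Real.exp (-t ^ 2)

theorem aux_tail (a : ℝ) : ∫ t in Ioi a, 2 * t * Real.exp (-t ^ 2) = Real.exp (-a ^ 2) := by
  have hi : Integrable (fun t : ℝ => 2 * t * Real.exp (-t ^ 2)) := by
    have := (integrable_mul_exp_neg_mul_sq (b := 1) one_pos).const_mul 2
    simpa [mul_assoc] using this
  have hd : ∀ x ∈ Ici a, HasDerivAt (fun t : ℝ => -Real.exp (-t ^ 2))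
      (2 * x * Real.exp (-x ^ 2)) x := by
    intro x _
    have := (((hasDerivAt_pow 2 x).neg).exp).neg
    refine HasDerivAt.congr_deriv (f := fun t : ℝ => -Real.exp (-t ^ 2)) this ?_
    simp only [Nat.cast_ofNat, Pi.neg_apply]
    ring
  have ht : Filter.Tendsto (fun t : ℝ => -Real.exp (-t ^ 2)) Filter.atTop (nhds 0) := by
    have h1 : Filter.Tendsto (fun t : ℝ => t ^ 2) Filter.atTop Filter.atTop :=
      Filter.tendsto_pow_atTop (by norm_num)
    have := (Real.tendsto_exp_neg_atTop_nhds_zero.comp h1).neg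
    simpa [Function.comp_def] using this
  rw [integral_Ioi_of_hasDerivAt_of_tendsto' hd hi.integrableOn ht]
  simp

theorem aux_shift (f : ℝ → ℝ) (a : ℝ) : ∫ u in Ioi (0:ℝ), f (u + a) = ∫ t in Ioi a, f t := by
  have := (measurePreserving_add_right (volume : Measure ℝ) a).setIntegral_preimage_emb
    (measurableEmbedding_addRight a) f (Ioi a)
  simpa using this

theorem J_rayleigh_clutter (γ σt σc : ℝ) (hγ : 0 < γ) (hσt : 0 < σt) (hσc : 0 < σc) :
    ∫ σ in Ioi (0 : ℝ),
        Real.exp (-(γ * σ) / σt) * ((2 * σ / σc ^ 2) * Real.exp (-(σ / σc) ^ 2))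
      = 1 - (Real.sqrt Real.pi * (γ * σc / σt) / 2) *
          Real.exp ((γ * σc / σt) ^ 2 / 4) * erfc ((γ * σc / σt) / 2) := by
  have h1 := integral_comp_mul_left_Ioi (fun σ : ℝ =>
    Real.exp (-(γ * σ) / σt) * ((2 * σ / σc ^ 2) * Real.exp (-(σ / σc) ^ 2))) 0 hσc
  rw [mul_zero, smul_eq_mul, eq_inv_mul_iff_mul_eq₀ hσc.ne'] at h1
  rw [← h1, ← integral_const_mul]
  obtain ⟨a, ha⟩ : ∃ a, a = γ * σc / σt / 2 := ⟨_, rfl⟩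
  have hν : γ * σc / σt = 2 * a := by rw [ha]; ring
  have h2 : ∀ u : ℝ, σc * (Real.exp (-(γ * (σc * u)) / σt) *
      ((2 * (σc * u) / σc ^ 2) * Real.exp (-(σc * u / σc) ^ 2)))
      = (fun t : ℝ => Real.exp (a ^ 2) *
        (2 * t * Real.exp (-t ^ 2) - 2 * a * Real.exp (-t ^ 2))) (u + a) := by
    intro u
    have e1 : -(γ * (σc * u)) / σt = -(2 * a * u) := by rw [← hν]; ring
    have e2 : σc * u / σc = u := by field_simp
    have e3 : Real.exp (-(2 * a * u)) * Real.exp (-u ^ 2)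
        = Real.exp (a ^ 2) * Real.exp (-(u + a) ^ 2) := by
      rw [← Real.exp_add, ← Real.exp_add]; congr 1; ring
    have e4 : σc * (2 * (σc * u) / σc ^ 2) = 2 * u := by field_simp
    rw [e1, e2]
    linear_combination (Real.exp (-(2 * a * u)) * Real.exp (-u ^ 2)) * e4 + 2 * u * e3
  simp_rw [h2]
  have hi : Integrable (fun t : ℝ => 2 * t * Real.exp (-t ^ 2)) := by
    have := (integrable_mul_exp_neg_mul_sq (b := 1) one_pos).const_mul 2
    simpa [mul_assoc] using this
  have hg : Integrable (fun t : ℝ => 2 * a * Real.exp (-t ^ 2)) := by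
    have := (integrable_exp_neg_mul_sq (b := 1) one_pos).const_mul (2 * a)
    simpa using this
  rw [aux_shift (fun t : ℝ => Real.exp (a ^ 2) *
        (2 * t * Real.exp (-t ^ 2) - 2 * a * Real.exp (-t ^ 2))) a,
    integral_const_mul, integral_sub hi.integrableOn hg.integrableOn, aux_tail,
    integral_const_mul, hν, erfc]
  have e5 : Real.exp (a ^ 2) * Real.exp (-a ^ 2) = 1 := by
    rw [← Real.exp_add]; simp
  have e6 : (2 * a) ^ 2 / 4 = a ^ 2 := by ring
  have e7 : 2 * a / 2 = a := by ring
  have hp : Real.sqrt Real.pi ≠ 0 := by positivity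
  rw [e6, e7, mul_sub, e5]
  field_simp
end

section
/- The function g(ν) = (√π·ν/2) · exp(ν²/4) · erfc(ν/2) is strictly increasing on (0, ∞) and satisfies 0 < g(ν) < 1 for every ν > 0. Equivalently, the Rayleigh clutter term J(ν) = ∫₀^∞ exp(-νu)·2u·exp(-u²) du is strictly decreasing in ν on (0, ∞) with values in (0, 1). -/
open MeasureTheory Real Set

lemma aux_int1 {a : ℝ} (ha : 0 ≤ a) :
    IntegrableOn (fun u : ℝ => Real.exp (-(a * u)) * (2 * u * Real.exp (-u ^ 2))) (Ioi 0) := by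
  have h : Integrable (fun u : ℝ => 2 * (u * Real.exp (-1 * u ^ 2))) :=
    (integrable_mul_exp_neg_mul_sq (b := 1) one_pos).const_mul 2
  refine Integrable.mono h.integrableOn (by fun_prop) ?_
  filter_upwards [ae_restrict_mem measurableSet_Ioi] with u hu
  have hu' : (0:ℝ) < u := hu
  have h1 : Real.exp (-(a * u)) ≤ 1 := Real.exp_le_one_iff.2 (by nlinarith [mul_nonneg ha hu'.le])
  have h2 : 2 * (u * Real.exp (-1 * u ^ 2)) = 2 * u * Real.exp (-u ^ 2) := by
    rw [neg_one_mul]; ring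
  rw [h2, Real.norm_of_nonneg (by positivity), Real.norm_of_nonneg (by positivity)]
  exact mul_le_of_le_one_left (by positivity) h1

lemma aux_shift_s4 (a : ℝ) :
    ∫ u in Ioi (0:ℝ), Real.exp (-(a * u)) * Real.exp (-u ^ 2)
      = Real.exp (a ^ 2 / 4) * ∫ t in Ioi (a / 2), Real.exp (-t ^ 2) := by
  have h := (measurePreserving_add_right (volume : Measure ℝ) (a / 2)).setIntegral_preimage_emb
    (measurableEmbedding_addRight (a / 2)) (fun t => Real.exp (-t ^ 2)) (Ioi (a / 2))
  have hs : (fun x : ℝ => x + a / 2) ⁻¹' Ioi (a / 2) = Ioi 0 := by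
    ext x; simp
  rw [hs] at h
  rw [← h, ← integral_const_mul]
  congr 1
  ext u
  rw [← Real.exp_add, ← Real.exp_add]
  congr 1
  ring

lemma aux_int2 {a : ℝ} (ha : 0 ≤ a) :
    IntegrableOn (fun u : ℝ => Real.exp (-(a * u)) * Real.exp (-u ^ 2)) (Ioi 0) := by
  have h : Integrable (fun u : ℝ => Real.exp (-1 * u ^ 2)) :=
    integrable_exp_neg_mul_sq one_pos
  refine Integrable.mono h.integrableOn (by fun_prop) ?_
  filter_upwards [ae_restrict_mem measurableSet_Ioi] with u hu
  have hu' : (0:ℝ) < u := hu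
  have h1 : Real.exp (-(a * u)) ≤ 1 := Real.exp_le_one_iff.2 (by nlinarith [mul_nonneg ha hu'.le])
  rw [neg_one_mul, Real.norm_of_nonneg (by positivity), Real.norm_of_nonneg (by positivity)]
  exact mul_le_of_le_one_left (by positivity) h1

lemma aux_sum {a : ℝ} (ha : 0 ≤ a) :
    (∫ u in Ioi (0:ℝ), Real.exp (-(a * u)) * (2 * u * Real.exp (-u ^ 2)))
      + a * ∫ u in Ioi (0:ℝ), Real.exp (-(a * u)) * Real.exp (-u ^ 2) = 1 := by
  rw [← integral_const_mul, ← integral_add (aux_int1 ha) ((aux_int2 ha).const_mul a)]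
  have hd : ∀ x ∈ Ici (0:ℝ), HasDerivAt (fun u : ℝ => -Real.exp (-(a * u) + -u ^ 2))
      (Real.exp (-(a * x)) * (2 * x * Real.exp (-x ^ 2))
        + a * (Real.exp (-(a * x)) * Real.exp (-x ^ 2))) x := by
    intro x _
    have h1 : HasDerivAt (fun u : ℝ => -(a * u) + -u ^ 2) (-(a * 1) + -(2 * x)) x := by
      have := ((hasDerivAt_id x).const_mul a).neg.add (hasDerivAt_pow 2 x).neg
      exact this.congr_deriv (by simp)
    refine h1.exp.neg.congr_deriv ?_
    rw [Real.exp_add]; ring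
  have ht : Filter.Tendsto (fun u : ℝ => -Real.exp (-(a * u) + -u ^ 2)) Filter.atTop (nhds 0) := by
    rw [← neg_zero]
    refine Filter.Tendsto.neg (Real.tendsto_exp_atBot.comp ?_)
    refine Filter.tendsto_atBot_mono' _ ?_
      (Filter.tendsto_neg_atTop_atBot.comp (Filter.tendsto_pow_atTop (α := ℝ) two_ne_zero))
    filter_upwards [Filter.eventually_ge_atTop 0] with u hu
    have := mul_nonneg ha hu
    simp only [Function.comp]
    linarith
  rw [integral_Ioi_of_hasDerivAt_of_tendsto' hd
    ((aux_int1 ha).add ((aux_int2 ha).const_mul a)) ht]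
  simp

lemma aux_pos {f : ℝ → ℝ} (hf : ∀ u, 0 < u → 0 < f u) (hi : IntegrableOn f (Ioi 0)) :
    0 < ∫ u in Ioi (0:ℝ), f u := by
  rw [setIntegral_pos_iff_support_of_nonneg_ae _ hi]
  · have : Function.support f ∩ Ioi 0 = Ioi 0 :=
      inter_eq_self_of_subset_right fun u hu => (hf u hu).ne'
    rw [this]; simp
  · filter_upwards [ae_restrict_mem measurableSet_Ioi] with u hu
    exact (hf u hu).le

lemma aux_anti {a b : ℝ} (ha : 0 ≤ a) (hab : a < b) :
    (∫ u in Ioi (0:ℝ), Real.exp (-(b * u)) * (2 * u * Real.exp (-u ^ 2)))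
      < ∫ u in Ioi (0:ℝ), Real.exp (-(a * u)) * (2 * u * Real.exp (-u ^ 2)) := by
  have hia := aux_int1 ha
  have hib := aux_int1 (ha.trans hab.le)
  rw [← sub_pos, ← integral_sub hia hib]
  refine aux_pos (fun u hu => ?_) (hia.sub hib)
  have h : Real.exp (-(b * u)) < Real.exp (-(a * u)) :=
    Real.exp_lt_exp.2 (neg_lt_neg (mul_lt_mul_of_pos_right hab hu))
  exact sub_pos.2 (mul_lt_mul_of_pos_right h (by positivity))

lemma aux_g {a : ℝ} (ha : 0 ≤ a) :
    (Real.sqrt Real.pi * a / 2) * Real.exp (a ^ 2 / 4) * erfc (a / 2)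
      = 1 - ∫ u in Ioi (0:ℝ), Real.exp (-(a * u)) * (2 * u * Real.exp (-u ^ 2)) := by
  have h := aux_sum ha
  rw [aux_shift_s4] at h
  rw [← h, erfc]
  have : Real.sqrt Real.pi ≠ 0 := (Real.sqrt_pos.2 Real.pi_pos).ne'
  field_simp
  ring

lemma aux_mem {a : ℝ} (ha : 0 < a) :
    (∫ u in Ioi (0:ℝ), Real.exp (-(a * u)) * (2 * u * Real.exp (-u ^ 2))) ∈ Ioo (0:ℝ) 1 := by
  refine ⟨aux_pos (fun u hu => by positivity) (aux_int1 ha.le), ?_⟩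
  have h := aux_sum (le_refl (0:ℝ))
  rw [zero_mul, add_zero] at h
  exact (aux_anti le_rfl ha).trans_eq h

/-- `g(ν) = (√π ν/2) exp(ν²/4) erfc(ν/2)` is strictly increasing on `(0,∞)` with
values in `(0,1)`; equivalently the Rayleigh clutter term
`J(ν) = ∫₀^∞ exp(-νu)·2u·exp(-u²) du` is strictly decreasing on `(0,∞)` with values
in `(0,1)`. -/
theorem rayleigh_clutter_term_monotone :
    (StrictMonoOn (fun ν : ℝ =>
        (Real.sqrt Real.pi * ν / 2) * Real.exp (ν ^ 2 / 4) * erfc (ν / 2)) (Ioi 0)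
      ∧ ∀ ν : ℝ, 0 < ν →
        (Real.sqrt Real.pi * ν / 2) * Real.exp (ν ^ 2 / 4) * erfc (ν / 2) ∈ Ioo (0 : ℝ) 1)
    ∧ (StrictAntiOn (fun ν : ℝ =>
        ∫ u in Ioi (0 : ℝ), Real.exp (-(ν * u)) * (2 * u * Real.exp (-u ^ 2))) (Ioi 0)
      ∧ ∀ ν : ℝ, 0 < ν →
        (∫ u in Ioi (0 : ℝ), Real.exp (-(ν * u)) * (2 * u * Real.exp (-u ^ 2)))
          ∈ Ioo (0 : ℝ) 1) := by
  refine ⟨⟨?_, ?_⟩, ?_, fun ν hν => aux_mem hν⟩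
  · intro a ha b hb hab
    have ha' : (0:ℝ) < a := ha
    have hb' : (0:ℝ) < b := hb
    show _ * _ * _ < _ * _ * _
    rw [aux_g ha'.le, aux_g hb'.le]
    have := aux_anti ha'.le hab
    linarith
  · intro ν hν
    rw [aux_g hν.le]
    have h := aux_mem hν
    exact ⟨by linarith [h.2], by linarith [h.1]⟩
  · intro a ha b _ hab
    exact aux_anti (le_of_lt ha) hab
end
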